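/- For the q-symmetrizer \mathcal{H}_k^q and a q-super Manin matrix M, the identity \mathcal{H}_k^q M_1 \cdots M_k \mathcal{H}_k^q = M_1 \cdots M_k \mathcal{H}_k^q holds in A \otimes End(\mathbb{C}^{m|n})^{\otimes k}. -/

import Mathlib

open scoped BigOperators Classical
open Finset

namespace QSM

/-- Parity of a basis index of `ℂ^{m|n}`: `0` (even) for indices `< m`, `1` (odd) otherwise. -/
def pa (m : ℕ) {N : ℕ} (i : Fin N) : ℕ := if (i : ℕ) < m then 0 else 1

/-- The sign `ε(i - j)`: `1` if `i > j`, `0` if `i = j`, `-1` if `i < j`. -/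
def eps {N : ℕ} (i j : Fin N) : ℤ :=
  if (j : ℕ) < (i : ℕ) then 1 else if (i : ℕ) < (j : ℕ) then -1 else 0

variable {B : Type*} [Ring B] [Algebra ℂ B]

/-- Map a complex matrix into a matrix over the `ℂ`-algebra `B`. -/
noncomputable def cmap {I : Type*} (X : Matrix I I ℂ) : Matrix I I B :=
  X.map (algebraMap ℂ B)

/-- The super tensor product `E_{ij} ⊗ E_{kl}` of matrix units, as an operator on the
graded tensor square of `ℂ^{m|n}` (super sign conventions). -/
noncomputable def stu (m : ℕ) {N : ℕ} (i j k l : Fin N) :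
    Matrix (Fin N × Fin N) (Fin N × Fin N) ℂ :=
  Matrix.of fun p r =>
    ((-1 : ℂ) ^ ((pa m k + pa m l) * pa m r.1)) *
      (if p.1 = i ∧ r.1 = j then 1 else 0) * (if p.2 = k ∧ r.2 = l then 1 else 0)

/-- The operator `P^q = ∑_{i,j} q^{ε(i-j)} (-1)^{\bar j} E_{ij} ⊗ E_{ji}` on
`(ℂ^{m|n})^{⊗2}`. -/
noncomputable def Pq (q : ℂ) (m : ℕ) {N : ℕ} : Matrix (Fin N × Fin N) (Fin N × Fin N) ℂ :=
  ∑ i : Fin N, ∑ j : Fin N, (q ^ eps i j * (-1 : ℂ) ^ pa m j) • stu m i j j i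

/-- `M₁ = ∑ (-1)^{\bar i\bar j+\bar j} M_{ij} ⊗ E_{ij} ⊗ 1` on the tensor square. -/
noncomputable def Mone (m : ℕ) {N : ℕ} (M : Matrix (Fin N) (Fin N) B) :
    Matrix (Fin N × Fin N) (Fin N × Fin N) B :=
  Matrix.of fun p r =>
    if p.2 = r.2 then
      ((-1 : ℂ) ^ (pa m p.1 * pa m r.1 + pa m r.1)) • M p.1 r.1
    else 0

/-- `M₂ = ∑ (-1)^{\bar i\bar j+\bar j} M_{ij} ⊗ 1 ⊗ E_{ij}` on the tensor square
(with the super sign of `1 ⊗ E_{ij}`). -/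
noncomputable def Mtwo (m : ℕ) {N : ℕ} (M : Matrix (Fin N) (Fin N) B) :
    Matrix (Fin N × Fin N) (Fin N × Fin N) B :=
  Matrix.of fun p r =>
    if p.1 = r.1 then
      ((-1 : ℂ) ^ (pa m p.2 * pa m r.2 + pa m r.2 + (pa m p.2 + pa m r.2) * pa m r.1)) •
        M p.2 r.2
    else 0

/-- The `q`-super Manin matrix condition in matrix form:
`(1 - P^q) M₁ M₂ (1 + P^q) = 0`. -/
def IsManin (q : ℂ) (m : ℕ) {N : ℕ} (M : Matrix (Fin N) (Fin N) B) : Prop :=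
  (1 - cmap (Pq q m)) * Mone m M * Mtwo m M * (1 + cmap (Pq q m)) = 0

/-- The entrywise relations of the right quantum superalgebra `𝓜_{m|n}`. -/
def ManinRel (q : ℂ) (m : ℕ) {N : ℕ} (M : Matrix (Fin N) (Fin N) B) : Prop :=
  (∀ i j, pa m i = 1 → pa m j = 0 → M i j * M i j = 0) ∧
  (∀ i k l, pa m i = 1 →
    M i k * M i l = (q ^ eps l k * (-1 : ℂ) ^ ((pa m k + 1) * (pa m l + 1))) • (M i l * M i k)) ∧
  (∀ i j k, pa m k = 0 →
    M i k * M j k = (q ^ eps i j * (-1 : ℂ) ^ (pa m i * pa m j)) • (M j k * M i k)) ∧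
  (∀ i j k l,
    M i j * M k l -
        (q ^ (eps i k + eps l j) * (-1 : ℂ) ^ ((pa m i + pa m j) * (pa m k + pa m l))) •
          (M k l * M i j)
      = (q ^ eps i k * (-1 : ℂ) ^ (pa m i * pa m k + pa m j * pa m k + pa m i * pa m j)) •
            (M k j * M i l)
        - (q ^ eps l j * (-1 : ℂ) ^ (pa m j * pa m k + pa m j * pa m l + pa m k * pa m l)) •
            (M i l * M k j))

/-- The operator `P^q_σ` on `(ℂ^{m|n})^{⊗k}` (defined via reduced decompositions of `σ`;
equivalently, by the explicit inversion formula used here). -/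
noncomputable def Pperm (q : ℂ) (m : ℕ) {N k : ℕ} (σ : Equiv.Perm (Fin k)) :
    Matrix (Fin k → Fin N) (Fin k → Fin N) ℂ :=
  Matrix.of fun f g =>
    if f = g ∘ ⇑σ⁻¹ then
      ∏ p ∈ Finset.univ.filter (fun p : Fin k × Fin k => p.1 < p.2 ∧ σ p.2 < σ p.1),
        (q ^ eps (g p.1) (g p.2) * (-1 : ℂ) ^ (pa m (g p.1) * pa m (g p.2)))
    else 0

/-- The `q`-antisymmetrizer over the tensor positions in `S`. -/
noncomputable def AqS (q : ℂ) (m : ℕ) {N k : ℕ} (S : Finset (Fin k)) :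
    Matrix (Fin k → Fin N) (Fin k → Fin N) ℂ :=
  (S.card.factorial : ℂ)⁻¹ •
    ∑ σ ∈ Finset.univ.filter (fun σ : Equiv.Perm (Fin k) => ∀ t ∉ S, σ t = t),
      (((Equiv.Perm.sign σ : ℤ) : ℂ)) • Pperm q m (N := N) σ

/-- The `q`-symmetrizer over the tensor positions in `S`. -/
noncomputable def HqS (q : ℂ) (m : ℕ) {N k : ℕ} (S : Finset (Fin k)) :
    Matrix (Fin k → Fin N) (Fin k → Fin N) ℂ :=
  (S.card.factorial : ℂ)⁻¹ •
    ∑ σ ∈ Finset.univ.filter (fun σ : Equiv.Perm (Fin k) => ∀ t ∉ S, σ t = t),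
      Pperm q m (N := N) σ

/-- `M_a`: the copy of `M` in the `a`-th slot of `B ⊗ End(ℂ^{m|n})^{⊗k}`, with the super
sign factors `(-1)^{\bar i\bar j+\bar j}` and the super signs of `1⊗⋯⊗E_{ij}⊗⋯⊗1`. -/
noncomputable def Mslot (m : ℕ) {N k : ℕ} (M : Matrix (Fin N) (Fin N) B) (a : Fin k) :
    Matrix (Fin k → Fin N) (Fin k → Fin N) B :=
  Matrix.of fun f g =>
    if ∀ b, b ≠ a → f b = g b then
      ((-1 : ℂ) ^ (pa m (f a) * pa m (g a) + pa m (g a)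
          + (pa m (f a) + pa m (g a)) *
              ∑ b ∈ Finset.univ.filter (fun b => b < a), pa m (g b))) •
        M (f a) (g a)
    else 0

/-- The product `M₁ M₂ ⋯ M_k`. -/
noncomputable def MProd (m : ℕ) {N : ℕ} (M : Matrix (Fin N) (Fin N) B) (k : ℕ) :
    Matrix (Fin k → Fin N) (Fin k → Fin N) B :=
  (List.ofFn fun a : Fin k => Mslot m M a).prod

/-- The `q`-super Manin condition in the form `𝒜₂^q M₁ M₂ ℋ₂^q = 0`. -/
def IsManin2 (q : ℂ) (m : ℕ) {N : ℕ} (M : Matrix (Fin N) (Fin N) B) : Prop :=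
  cmap (AqS q m (Finset.univ : Finset (Fin 2))) * Mslot m M (0 : Fin 2) *
      Mslot m M (1 : Fin 2) * cmap (HqS q m (Finset.univ : Finset (Fin 2))) = 0

/-- The supertrace `str_{1,…,k}` over all `k` tensor slots. -/
noncomputable def strAll (m : ℕ) {N k : ℕ}
    (X : Matrix (Fin k → Fin N) (Fin k → Fin N) B) : B :=
  ∑ f : Fin k → Fin N, ((-1 : ℂ) ^ (∑ t, pa m (f t))) • X f f

/-- The supertrace of an `N × N` matrix. -/
noncomputable def strM (m : ℕ) {N : ℕ} (X : Matrix (Fin N) (Fin N) B) : B :=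
  ∑ i, ((-1 : ℂ) ^ pa m i) • X i i

/-- The star product `B * C = str₁ (P^q_{12} B₁ C₂)`. -/
noncomputable def starMul (q : ℂ) (m : ℕ) {N : ℕ} (X Y : Matrix (Fin N) (Fin N) B) :
    Matrix (Fin N) (Fin N) B :=
  Matrix.of fun i j =>
    ((-1 : ℂ) ^ (pa m i * pa m j + pa m j)) •
      ∑ a : Fin N, ((-1 : ℂ) ^ (pa m a * (1 + pa m i + pa m j))) •
        ((cmap (Pperm q m (Equiv.swap (0 : Fin 2) 1)) * Mslot m X (0 : Fin 2) *
            Mslot m Y (1 : Fin 2) :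
          Matrix (Fin 2 → Fin N) (Fin 2 → Fin N) B) ![a, i] ![a, j])

/-- The powers `M^{[k]}` of `M` with respect to the star product. -/
noncomputable def Mpow (q : ℂ) (m : ℕ) {N : ℕ} (M : Matrix (Fin N) (Fin N) B) :
    ℕ → Matrix (Fin N) (Fin N) B
  | 0 => 1
  | 1 => M
  | (j + 2) => starMul q m (Mpow q m M (j + 1)) M

/-- Coefficient of `t^k` in `A(t) = ∑ (-t)^k str_{1,…,k}(𝒜_k^q M₁⋯M_k)`. -/
noncomputable def coefA (q : ℂ) (m : ℕ) {N : ℕ} (M : Matrix (Fin N) (Fin N) B) (k : ℕ) : B :=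
  ((-1 : ℂ) ^ k) •
    strAll m (cmap (AqS q m (Finset.univ : Finset (Fin k))) * MProd m M k)

/-- Coefficient of `t^k` in `S(t) = ∑ t^k str_{1,…,k}(ℋ_k^q M₁⋯M_k)`. -/
noncomputable def coefS (q : ℂ) (m : ℕ) {N : ℕ} (M : Matrix (Fin N) (Fin N) B) (k : ℕ) : B :=
  strAll m (cmap (HqS q m (Finset.univ : Finset (Fin k))) * MProd m M k)

/-- Coefficient of `t^k` in `T(t) = ∑ t^k str(M^{[k+1]})`. -/
noncomputable def coefT (q : ℂ) (m : ℕ) {N : ℕ} (M : Matrix (Fin N) (Fin N) B) (k : ℕ) : B :=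
  strM m (Mpow q m M (k + 1))

/-- Coefficients `M^{i_1…i_k}_{j_1…j_k}` of `𝒜_k^q M₁⋯M_k` in the basis
`E_{i_1j_1} ⊗ ⋯ ⊗ E_{i_kj_k}` (super sign conventions). -/
noncomputable def MIJ (q : ℂ) (m : ℕ) {N k : ℕ} (M : Matrix (Fin N) (Fin N) B)
    (f g : Fin k → Fin N) : B :=
  ((-1 : ℂ) ^ (∑ a : Fin k, (pa m (f a) + pa m (g a)) *
      ∑ b ∈ Finset.univ.filter (fun b => b < a), pa m (g b))) •
    ((cmap (AqS q m (Finset.univ : Finset (Fin k))) * MProd m M k :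
      Matrix (Fin k → Fin N) (Fin k → Fin N) B) f g)

/-- Number of inversions (the length `l(σ)`) of a permutation. -/
def invCount {r : ℕ} (σ : Equiv.Perm (Fin r)) : ℕ :=
  (Finset.univ.filter fun p : Fin r × Fin r => p.1 < p.2 ∧ σ p.2 < σ p.1).card

/-- The quantum determinant `det_q(A) = ∑_σ (-q)^{-l(σ)} A_{σ(1),1} ⋯ A_{σ(r),r}`. -/
noncomputable def detq (q : ℂ) {r : ℕ} (A : Matrix (Fin r) (Fin r) B) : B :=
  ∑ σ : Equiv.Perm (Fin r),
    ((-q) ^ (-(invCount σ : ℤ))) • (List.ofFn fun i : Fin r => A (σ i) i).prod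

/-- The quantum Berezinian of a type `(r|s)` matrix `A` with (two-sided) inverse `Ainv`. -/
noncomputable def Ber (q : ℂ) (r s : ℕ) (A Ainv : Matrix (Fin (r + s)) (Fin (r + s)) B) : B :=
  (∑ σ : Equiv.Perm (Fin r), ((-q) ^ (-(invCount σ : ℤ))) •
      (List.ofFn fun i : Fin r => A (Fin.castAdd s (σ i)) (Fin.castAdd s i)).prod) *
  (∑ ρ : Equiv.Perm (Fin s), ((-q) ^ (-(invCount ρ : ℤ))) •
      (List.ofFn fun j : Fin s => Ainv (Fin.natAdd r j) (Fin.natAdd r (ρ j))).prod)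

/-- The `Π ∘ st` transform of a type `(r'|s')` matrix: a type `(s'|r')` matrix. -/
noncomputable def PiSt (r' s' : ℕ) (A : Matrix (Fin (r' + s')) (Fin (r' + s')) B) :
    Matrix (Fin (s' + r')) (Fin (s' + r')) B :=
  Matrix.of fun i j =>
    ((-1 : ℂ) ^ (pa s' i * (pa s' i + pa s' j))) •
      A (Fin.rev (Fin.cast (Nat.add_comm s' r') j)) (Fin.rev (Fin.cast (Nat.add_comm s' r') i))

/-- Left corner embedding `Fin a → Fin b`. -/
def embL (a b : ℕ) (h : a ≤ b) : Fin a → Fin b :=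
  fun i => ⟨(i : ℕ), lt_of_lt_of_le i.isLt h⟩

/-- Embedding of `Fin a` into `Fin b` shifted by `c`. -/
def embR (c a b : ℕ) (h : c + a ≤ b) : Fin a → Fin b :=
  fun i => ⟨c + (i : ℕ), by have := i.isLt; omega⟩

/-- `P^q ⊗ 1` on the triple tensor space. -/
noncomputable def P12 (q : ℂ) (m : ℕ) {N : ℕ} :
    Matrix (Fin N × Fin N × Fin N) (Fin N × Fin N × Fin N) ℂ :=
  Matrix.of fun p r =>
    Pq q m (p.1, p.2.1) (r.1, r.2.1) * (if p.2.2 = r.2.2 then 1 else 0)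

/-- `1 ⊗ P^q` on the triple tensor space (no extra super sign: `P^q` is even). -/
noncomputable def P23 (q : ℂ) (m : ℕ) {N : ℕ} :
    Matrix (Fin N × Fin N × Fin N) (Fin N × Fin N × Fin N) ℂ :=
  Matrix.of fun p r =>
    (if p.1 = r.1 then 1 else 0) * Pq q m (p.2.1, p.2.2) (r.2.1, r.2.2)

/-- The braiding coefficient of `P^q` on `e_a ⊗ e_b`. -/
noncomputable def braidCoeff (q : ℂ) (m : ℕ) {N : ℕ} (a b : Fin N) : ℂ :=
  q ^ eps a b * (-1 : ℂ) ^ (pa m a * pa m b)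

theorem braidCoeff_mul_swap {q : ℂ} (hq : q ≠ 0) (m : ℕ) {N : ℕ} (a b : Fin N) :
    braidCoeff q m a b * braidCoeff q m b a = 1 := by
  have h1 : q ^ eps a b * q ^ eps b a = 1 := by
    rw [← zpow_add₀ hq]
    have : eps a b + eps b a = 0 := by unfold eps; split_ifs <;> omega
    rw [this, zpow_zero]
  have h2 : (-1 : ℂ) ^ (pa m a * pa m b) * (-1 : ℂ) ^ (pa m b * pa m a) = 1 := by
    rw [mul_comm (pa m b), ← pow_add, ← two_mul, pow_mul]; simp
  unfold braidCoeff
  rw [mul_mul_mul_comm, h1, h2, one_mul]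

/-- The coefficient of `P^q_σ` on the basis vector indexed by `g`. -/
noncomputable def permCoeff (q : ℂ) (m : ℕ) {N k : ℕ} (σ : Equiv.Perm (Fin k))
    (g : Fin k → Fin N) : ℂ :=
  ∏ p ∈ Finset.univ.filter (fun p : Fin k × Fin k => p.1 < p.2 ∧ σ p.2 < σ p.1),
    braidCoeff q m (g p.1) (g p.2)

theorem Pperm_apply (q : ℂ) (m : ℕ) {N k : ℕ} (σ : Equiv.Perm (Fin k)) (f g : Fin k → Fin N) :
    Pperm q m σ f g = if f = g ∘ ⇑σ⁻¹ then permCoeff q m σ g else 0 := rfl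

/-- A product of a symmetric function over pairs `i < j` is invariant under relabelling. -/
theorem prod_lt_comp_perm {k : ℕ} (u : Fin k → Fin k → ℂ) (hu : ∀ i j, u i j = u j i)
    (τ : Equiv.Perm (Fin k)) :
    ∏ p ∈ Finset.univ.filter (fun p : Fin k × Fin k => p.1 < p.2), u (τ p.1) (τ p.2) =
      ∏ p ∈ Finset.univ.filter (fun p : Fin k × Fin k => p.1 < p.2), u p.1 p.2 := by
  let sortMap (ρ : Equiv.Perm (Fin k)) (p : Fin k × Fin k) : Fin k × Fin k :=
    if ρ p.1 < ρ p.2 then (ρ p.1, ρ p.2) else (ρ p.2, ρ p.1)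
  have hmem : ∀ ρ : Equiv.Perm (Fin k), ∀ p : Fin k × Fin k, p.1 < p.2 →
      (sortMap ρ p).1 < (sortMap ρ p).2 := by
    intro ρ p hp
    by_cases h : ρ p.1 < ρ p.2
    · simp [sortMap, h]
    · have hne : ρ p.1 ≠ ρ p.2 := fun e => hp.ne (ρ.injective e)
      simpa [sortMap, h] using lt_of_le_of_ne (not_lt.1 h) hne.symm
  have hinv : ∀ ρ ρ' : Equiv.Perm (Fin k), (∀ x, ρ' (ρ x) = x) → ∀ p : Fin k × Fin k,
      p.1 < p.2 → sortMap ρ' (sortMap ρ p) = p := by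
    intro ρ ρ' hρ p hp
    by_cases h : ρ p.1 < ρ p.2
    · simp [sortMap, h, hρ, hp]
    · simp [sortMap, h, hρ, hp.not_gt]
  refine Finset.prod_bij' (fun p _ => sortMap τ p) (fun p _ => sortMap τ⁻¹ p) ?_ ?_ ?_ ?_ ?_
  · intro p hp; simpa using hmem τ p (by simpa using hp)
  · intro p hp; simpa using hmem τ⁻¹ p (by simpa using hp)
  · intro p hp; exact hinv τ τ⁻¹ (by simp) p (by simpa using hp)
  · intro p hp; exact hinv τ⁻¹ τ (by simp) p (by simpa using hp)
  · intro p _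
    by_cases h : τ p.1 < τ p.2
    · simp [sortMap, h]
    · simp [sortMap, h, hu (τ p.1)]

theorem permCoeff_mul {q : ℂ} (hq : q ≠ 0) (m : ℕ) {N k : ℕ} (σ τ : Equiv.Perm (Fin k))
    (g : Fin k → Fin N) :
    permCoeff q m (σ * τ) g = permCoeff q m σ (g ∘ ⇑τ⁻¹) * permCoeff q m τ g := by
  let u (i j : Fin k) : ℂ :=
    if i < j ∧ σ j < σ i then braidCoeff q m (g (τ⁻¹ i)) (g (τ⁻¹ j))
    else if j < i ∧ σ i < σ j then braidCoeff q m (g (τ⁻¹ j)) (g (τ⁻¹ i)) else 1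
  have hu : ∀ i j, u i j = u j i := by
    intro i j
    by_cases h : i < j ∧ σ j < σ i
    · simp [u, h, h.1.not_gt]
    · simp [u, h]
  have hfilter : ∀ (ρ : Equiv.Perm (Fin k)) (h : Fin k → Fin N), permCoeff q m ρ h =
      ∏ p ∈ Finset.univ.filter (fun p : Fin k × Fin k => p.1 < p.2),
        if ρ p.2 < ρ p.1 then braidCoeff q m (h p.1) (h p.2) else 1 := by
    intro ρ h
    rw [permCoeff, ← Finset.prod_filter, Finset.filter_filter]
  have hσ : permCoeff q m σ (g ∘ ⇑τ⁻¹) =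
      ∏ p ∈ Finset.univ.filter (fun p : Fin k × Fin k => p.1 < p.2), u p.1 p.2 := by
    rw [hfilter]
    refine Finset.prod_congr rfl fun p hp => ?_
    have hp : p.1 < p.2 := by simpa using hp
    simp [u, hp, hp.not_gt]
  rw [hσ, ← prod_lt_comp_perm u hu τ, hfilter, hfilter, ← Finset.prod_mul_distrib]
  refine Finset.prod_congr rfl fun p hp => ?_
  have hp : p.1 < p.2 := by simpa using hp
  have hne : τ p.1 ≠ τ p.2 := fun e => hp.ne (τ.injective e)
  have hne' : σ (τ p.1) ≠ σ (τ p.2) := fun e => hne (σ.injective e)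
  rcases lt_or_gt_of_ne hne with h | h
  · have hinv : ∀ x, τ⁻¹ (τ x) = x := by simp
    simp only [u, h, h.not_gt, Equiv.Perm.mul_apply, hinv, true_and, false_and, if_false, mul_one]
    congr 1
  · rcases lt_or_gt_of_ne hne' with h' | h'
    · simp [u, h, h', h.not_gt, h'.not_gt, mul_comm, braidCoeff_mul_swap hq]
    · simp [u, h, h', h.not_gt, h'.not_gt]

theorem Pperm_mul {q : ℂ} (hq : q ≠ 0) (m : ℕ) {N k : ℕ} (σ τ : Equiv.Perm (Fin k)) :
    Pperm q m (N := N) σ * Pperm q m τ = Pperm q m (σ * τ) := by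
  ext f g
  rw [Matrix.mul_apply, Finset.sum_eq_single (g ∘ ⇑τ⁻¹)]
  · simp only [Pperm_apply, if_true, ite_mul, zero_mul, permCoeff_mul hq, mul_inv_rev,
      Equiv.Perm.coe_mul, Function.comp_assoc]
  · intro h _ hne
    rw [Pperm_apply q m τ, if_neg hne, mul_zero]
  · simp

theorem Pperm_one (q : ℂ) (m : ℕ) {N k : ℕ} :
    Pperm q m (N := N) (1 : Equiv.Perm (Fin k)) = 1 := by
  ext f g
  have : permCoeff q m (1 : Equiv.Perm (Fin k)) g = 1 := by
    refine Finset.prod_eq_one fun p hp => ?_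
    rw [Finset.mem_filter] at hp
    exact absurd hp.2.1 (not_lt_of_gt hp.2.2)
  simp [Pperm_apply, this, Matrix.one_apply]

theorem HqS_univ (q : ℂ) (m : ℕ) {N k : ℕ} :
    HqS q m (N := N) (Finset.univ : Finset (Fin k)) =
      (k.factorial : ℂ)⁻¹ • ∑ σ : Equiv.Perm (Fin k), Pperm q m σ := by
  simp [HqS]

theorem Pperm_mul_HqS {q : ℂ} (hq : q ≠ 0) (m : ℕ) {N k : ℕ} (σ : Equiv.Perm (Fin k)) :
    Pperm q m (N := N) σ * HqS q m Finset.univ = HqS q m Finset.univ := by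
  rw [HqS_univ, Matrix.mul_smul, Matrix.mul_sum]
  simp only [Pperm_mul hq]
  exact congrArg _ (Equiv.sum_comp (Equiv.mulLeft σ) fun τ => Pperm q m (N := N) τ)

theorem cmap_mul {I : Type*} [Fintype I] (X Y : Matrix I I ℂ) :
    cmap (B := B) (X * Y) = cmap X * cmap Y :=
  Matrix.map_mul

theorem cmap_one {I : Type*} [DecidableEq I] : cmap (B := B) (1 : Matrix I I ℂ) = 1 :=
  Matrix.map_one _ (map_zero _) (map_one _)

theorem cmap_smul {I : Type*} (c : ℂ) (X : Matrix I I ℂ) :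
    cmap (B := B) (c • X) = c • cmap X := by
  ext i j
  simp [cmap, Algebra.smul_def]

theorem cmap_add {I : Type*} (X Y : Matrix I I ℂ) :
    cmap (B := B) (X + Y) = cmap X + cmap Y :=
  Matrix.map_add _ (map_add _) X Y

theorem cmap_sub {I : Type*} (X Y : Matrix I I ℂ) :
    cmap (B := B) (X - Y) = cmap X - cmap Y :=
  Matrix.map_sub _ (map_sub _) X Y

theorem cmap_sum {I ι : Type*} (s : Finset ι) (X : ι → Matrix I I ℂ) :
    cmap (B := B) (∑ a ∈ s, X a) = ∑ a ∈ s, cmap (X a) := by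
  ext i j
  simp [cmap, Matrix.sum_apply]

theorem permCoeff_swap (q : ℂ) (m : ℕ) {N k : ℕ} {i j : Fin k} (hij : (j : ℕ) = i + 1)
    (g : Fin k → Fin N) : permCoeff q m (Equiv.swap i j) g = braidCoeff q m (g i) (g j) := by
  have : Finset.univ.filter (fun p : Fin k × Fin k =>
      p.1 < p.2 ∧ Equiv.swap i j p.2 < Equiv.swap i j p.1) = {(i, j)} := by
    ext ⟨a, b⟩
    rw [Finset.mem_filter]
    simp only [Finset.mem_univ, true_and, Finset.mem_singleton, Prod.mk.injEq,
      Equiv.swap_apply_def]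
    split_ifs <;> simp only [Fin.ext_iff, Fin.lt_def] at * <;> omega
  rw [permCoeff, this, Finset.prod_singleton]

section Slots

variable {N k : ℕ}

theorem Pperm_swap_mul_apply (q : ℂ) (m : ℕ) {i j : Fin k} (hij : (j : ℕ) = i + 1)
    (Z : Matrix (Fin k → Fin N) (Fin k → Fin N) B) (f g : Fin k → Fin N) :
    (cmap (Pperm q m (Equiv.swap i j)) * Z : Matrix (Fin k → Fin N) (Fin k → Fin N) B) f g =
      braidCoeff q m (f j) (f i) • Z (f ∘ Equiv.swap i j) g := by
  rw [Matrix.mul_apply, Finset.sum_eq_single (f ∘ Equiv.swap i j)]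
  · have : f = (f ∘ Equiv.swap i j) ∘ ⇑(Equiv.swap i j)⁻¹ := by ext; simp
    rw [cmap, Matrix.map_apply, Pperm_apply, if_pos this]
    simp [permCoeff_swap q m hij, Algebra.smul_def]
  · intro h _ hne
    have : f ≠ h ∘ ⇑(Equiv.swap i j)⁻¹ := by
      rintro rfl
      exact hne (by ext; simp)
    rw [cmap, Matrix.map_apply, Pperm_apply, if_neg this]
    simp
  · simp

theorem mul_Pperm_swap_apply (q : ℂ) (m : ℕ) {i j : Fin k} (hij : (j : ℕ) = i + 1)
    (Z : Matrix (Fin k → Fin N) (Fin k → Fin N) B) (f g : Fin k → Fin N) :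
    (Z * cmap (Pperm q m (Equiv.swap i j)) : Matrix (Fin k → Fin N) (Fin k → Fin N) B) f g =
      braidCoeff q m (g i) (g j) • Z f (g ∘ Equiv.swap i j) := by
  rw [Matrix.mul_apply, Finset.sum_eq_single (g ∘ Equiv.swap i j)]
  · simp [cmap, Pperm_apply, permCoeff_swap q m hij, Algebra.smul_def, Algebra.commutes]
  · intro h _ hne
    rw [cmap, Matrix.map_apply, Pperm_apply, if_neg (by simpa using hne)]
    simp
  · simp

/-- The number (with multiplicity) of odd indices of `g` before position `a`. -/
def parityBelow (m : ℕ) (a : Fin k) (g : Fin k → Fin N) : ℕ :=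
  ∑ b ∈ Finset.univ.filter (fun b => b < a), pa m (g b)

theorem Mslot_apply (m : ℕ) (M : Matrix (Fin N) (Fin N) B) (a : Fin k) (f g : Fin k → Fin N) :
    Mslot m M a f g = if ∀ b, b ≠ a → f b = g b then
      ((-1 : ℂ) ^ (pa m (f a) * pa m (g a) + pa m (g a)
        + (pa m (f a) + pa m (g a)) * parityBelow m a g)) • M (f a) (g a) else 0 := rfl

theorem parityBelow_comp_swap (m : ℕ) {i j : Fin k} (hij : (j : ℕ) = i + 1) {a : Fin k}
    (hj : a ≠ j) (g : Fin k → Fin N) :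
    parityBelow m a (g ∘ Equiv.swap i j) = parityBelow m a g := by
  refine Finset.sum_equiv (Equiv.swap i j) (fun b => ?_) (fun b _ => rfl)
  simp only [Finset.mem_filter, Finset.mem_univ, true_and, Equiv.swap_apply_def]
  split_ifs <;> simp only [Fin.ext_iff, Fin.lt_def, ne_eq] at * <;> omega

theorem parityBelow_congr (m : ℕ) {a : Fin k} {f g : Fin k → Fin N}
    (h : ∀ b, b < a → f b = g b) : parityBelow m a f = parityBelow m a g :=
  Finset.sum_congr rfl fun b hb => by rw [h b (by simpa using hb)]

theorem parityBelow_succ (m : ℕ) {i j : Fin k} (hij : (j : ℕ) = i + 1) (g : Fin k → Fin N) :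
    parityBelow m j g = pa m (g i) + parityBelow m i g := by
  have : Finset.univ.filter (fun b => b < j) = insert i (Finset.univ.filter (fun b => b < i)) := by
    ext b
    simp only [Finset.mem_filter, Finset.mem_univ, true_and, Finset.mem_insert, Fin.ext_iff,
      Fin.lt_def]
    omega
  rw [parityBelow, this, Finset.sum_insert (by simp)]
  rfl

theorem Pperm_swap_commute_Mslot (q : ℂ) (m : ℕ) {i j : Fin k} (hij : (j : ℕ) = i + 1)
    (M : Matrix (Fin N) (Fin N) B) {a : Fin k} (hi : a ≠ i) (hj : a ≠ j) :
    Commute (cmap (B := B) (Pperm q m (N := N) (Equiv.swap i j))) (Mslot m M a) := by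
  ext f g
  rw [Pperm_swap_mul_apply q m hij, mul_Pperm_swap_apply q m hij, Mslot_apply, Mslot_apply]
  have hcond : (∀ b, b ≠ a → (f ∘ Equiv.swap i j) b = g b) ↔
      ∀ b, b ≠ a → f b = (g ∘ Equiv.swap i j) b := by
    constructor <;> intro h b hb
    · have := h (Equiv.swap i j b) (by
        rw [Ne, Equiv.swap_apply_eq_iff, Equiv.swap_apply_of_ne_of_ne hi hj]; exact hb)
      simpa using this
    · have := h (Equiv.swap i j b) (by
        rw [Ne, Equiv.swap_apply_eq_iff, Equiv.swap_apply_of_ne_of_ne hi hj]; exact hb)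
      simpa using this
  by_cases h : ∀ b, b ≠ a → f b = (g ∘ Equiv.swap i j) b
  · rw [if_pos (hcond.2 h), if_pos h, h i hi.symm, h j hj.symm, parityBelow_comp_swap m hij hj]
    simp [Equiv.swap_apply_of_ne_of_ne hi hj]
  · rw [if_neg (fun h' => h (hcond.1 h')), if_neg h, smul_zero, smul_zero]

/-- The entry of `M₁ M₂` at row `(a, b)` and column `(c, d)`. -/
noncomputable def pairEntry (m : ℕ) (M : Matrix (Fin N) (Fin N) B) (a b c d : Fin N) : B :=
  ((-1 : ℂ) ^ (pa m a * pa m c + pa m c + (pa m b * pa m d + pa m d)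
    + (pa m b + pa m d) * pa m c)) • (M a c * M b d)

/-- The entry of `(1 - P^q) M₁ M₂ (1 + P^q)` at row `(a, b)` and column `(c, d)`. -/
noncomputable def maninEntry (q : ℂ) (m : ℕ) (M : Matrix (Fin N) (Fin N) B)
    (a b c d : Fin N) : B :=
  pairEntry m M a b c d - braidCoeff q m b a • pairEntry m M b a c d +
    braidCoeff q m c d •
      (pairEntry m M a b d c - braidCoeff q m b a • pairEntry m M b a d c)

theorem Mslot_mul_Mslot_apply (m : ℕ) {i j : Fin k} (hij : (j : ℕ) = i + 1)
    (M : Matrix (Fin N) (Fin N) B) (f g : Fin k → Fin N) :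
    (Mslot m M i * Mslot m M j) f g =
      if ∀ b, b ≠ i → b ≠ j → f b = g b then
        ((-1 : ℂ) ^ ((pa m (f i) + pa m (f j) + (pa m (g i) + pa m (g j))) * parityBelow m i g)) •
          pairEntry m M (f i) (f j) (g i) (g j) else 0 := by
  have hne : j ≠ i := by rw [Ne, Fin.ext_iff]; omega
  rw [Matrix.mul_apply, Finset.sum_eq_single (Function.update f i (g i))]
  · have h1 : ∀ b, b ≠ i → f b = Function.update f i (g i) b := fun b hb => by simp [hb]
    have hcond : (∀ b, b ≠ j → Function.update f i (g i) b = g b) ↔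
        ∀ b, b ≠ i → b ≠ j → f b = g b := by
      constructor
      · intro h b hb hb'
        rw [h1 b hb, h b hb']
      · intro h b hb
        by_cases hbi : b = i
        · subst hbi; simp
        · rw [← h1 b hbi, h b hbi hb]
    rw [Mslot_apply, Mslot_apply, if_pos h1]
    by_cases h : ∀ b, b ≠ i → b ≠ j → f b = g b
    · have hS : parityBelow m i (Function.update f i (g i)) = parityBelow m i g :=
        parityBelow_congr m fun b hb => hcond.2 h b (by
          rw [Ne, Fin.ext_iff]; rw [Fin.lt_def] at hb; omega)
      rw [if_pos h, if_pos (hcond.2 h), hS, parityBelow_succ m hij, pairEntry]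
      simp only [Function.update_self, Function.update_of_ne hne, smul_mul_smul_comm, smul_smul,
        ← pow_add]
      congr 2
      ring
    · rw [if_neg h, if_neg (fun h' => h (hcond.1 h')), mul_zero]
  · intro h _ hh
    by_cases h1 : ∀ b, b ≠ i → f b = h b
    · have h2 : ¬ ∀ b, b ≠ j → h b = g b := by
        intro h2
        refine hh (funext fun b => ?_)
        by_cases hb : b = i
        · subst hb; simp [h2 b hne.symm]
        · simp [hb, h1 b hb]
      rw [Mslot_apply m M j, if_neg h2, mul_zero]
    · rw [Mslot_apply, if_neg h1, zero_mul]
  · simp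

theorem manin_block_apply (q : ℂ) (m : ℕ) {i j : Fin k} (hij : (j : ℕ) = i + 1)
    (M : Matrix (Fin N) (Fin N) B) (f g : Fin k → Fin N) :
    ((1 - cmap (Pperm q m (Equiv.swap i j))) * (Mslot m M i * Mslot m M j) *
        (1 + cmap (Pperm q m (Equiv.swap i j))) : Matrix (Fin k → Fin N) (Fin k → Fin N) B) f g =
      if ∀ b, b ≠ i → b ≠ j → f b = g b then
        ((-1 : ℂ) ^ ((pa m (f i) + pa m (f j) + (pa m (g i) + pa m (g j))) * parityBelow m i g)) •
          maninEntry q m M (f i) (f j) (g i) (g j) else 0 := by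
  have hne : i ≠ j := by rw [Ne, Fin.ext_iff]; omega
  have hsw : ∀ b, b ≠ i → b ≠ j → Equiv.swap i j b = b := fun b =>
    Equiv.swap_apply_of_ne_of_ne
  have hS : parityBelow m i (g ∘ Equiv.swap i j) = parityBelow m i g :=
    parityBelow_comp_swap m hij hne g
  rw [mul_add, mul_one, Matrix.add_apply, mul_Pperm_swap_apply q m hij, sub_mul, one_mul,
    Matrix.sub_apply, Matrix.sub_apply, Pperm_swap_mul_apply q m hij,
    Pperm_swap_mul_apply q m hij]
  simp only [Mslot_mul_Mslot_apply m hij, hS, Function.comp_apply, Equiv.swap_apply_left,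
    Equiv.swap_apply_right]
  by_cases h : ∀ b, b ≠ i → b ≠ j → f b = g b
  · have e1 : ∀ b, b ≠ i → b ≠ j → f (Equiv.swap i j b) = g b := fun b hb hb' => by
      rw [hsw b hb hb', h b hb hb']
    have e2 : ∀ b, b ≠ i → b ≠ j → f b = g (Equiv.swap i j b) := fun b hb hb' => by
      rw [hsw b hb hb', h b hb hb']
    have e3 : ∀ b, b ≠ i → b ≠ j → f (Equiv.swap i j b) = g (Equiv.swap i j b) :=
      fun b hb hb' => by rw [hsw b hb hb', h b hb hb']
    rw [if_pos h, if_pos h, if_pos e1, if_pos e2, if_pos e3,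
      add_comm (pa m (f j)), add_comm (pa m (g j)), maninEntry]
    module
  · have e1 : ¬ ∀ b, b ≠ i → b ≠ j → f (Equiv.swap i j b) = g b := fun h' =>
      h fun b hb hb' => by rw [← h' b hb hb', hsw b hb hb']
    have e2 : ¬ ∀ b, b ≠ i → b ≠ j → f b = g (Equiv.swap i j b) := fun h' =>
      h fun b hb hb' => by rw [h' b hb hb', hsw b hb hb']
    have e3 : ¬ ∀ b, b ≠ i → b ≠ j → f (Equiv.swap i j b) = g (Equiv.swap i j b) := fun h' =>
      h fun b hb hb' => by simpa only [hsw b hb hb'] using h' b hb hb'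
    rw [if_neg h, if_neg h, if_neg e1, if_neg e2, if_neg e3]
    simp

end Slots

theorem perm_fin_two_univ :
    (Finset.univ : Finset (Equiv.Perm (Fin 2))) = {1, Equiv.swap 0 1} := by
  decide

theorem HqS_two (q : ℂ) (m : ℕ) {N : ℕ} :
    HqS q m (N := N) (Finset.univ : Finset (Fin 2)) =
      (2 : ℂ)⁻¹ • (1 + Pperm q m (Equiv.swap 0 1)) := by
  rw [HqS_univ, perm_fin_two_univ, Finset.sum_pair (by decide), Pperm_one]
  simp

theorem AqS_two (q : ℂ) (m : ℕ) {N : ℕ} :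
    AqS q m (N := N) (Finset.univ : Finset (Fin 2)) =
      (2 : ℂ)⁻¹ • (1 - Pperm q m (Equiv.swap 0 1)) := by
  have : AqS q m (N := N) (Finset.univ : Finset (Fin 2)) = (2 : ℂ)⁻¹ •
      ∑ σ : Equiv.Perm (Fin 2), (((Equiv.Perm.sign σ : ℤ) : ℂ)) • Pperm q m σ := by
    simp [AqS]
  rw [this, perm_fin_two_univ, Finset.sum_pair (by decide), Pperm_one,
    Equiv.Perm.sign_swap (by decide)]
  simp [sub_eq_add_neg]

theorem IsManin2.maninEntry_eq_zero {q : ℂ} {m N : ℕ} {M : Matrix (Fin N) (Fin N) B}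
    (hM : IsManin2 q m M) (a b c d : Fin N) : maninEntry q m M a b c d = 0 := by
  have h : (1 - cmap (Pperm q m (Equiv.swap (0 : Fin 2) 1))) *
      (Mslot m M (0 : Fin 2) * Mslot m M 1) *
        (1 + cmap (Pperm q m (Equiv.swap (0 : Fin 2) 1))) = 0 := by
    unfold IsManin2 at hM
    rw [AqS_two, HqS_two, cmap_smul, cmap_smul, cmap_sub, cmap_add, cmap_one] at hM
    simp only [smul_mul_assoc, mul_smul_comm] at hM
    simpa only [smul_eq_zero_iff_right (inv_ne_zero (two_ne_zero (α := ℂ))), mul_assoc] using hM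
  have := congrFun (congrFun h ![a, b]) ![c, d]
  rw [manin_block_apply q m (by simp)] at this
  simpa [Fin.forall_fin_two] using this

theorem MProd_manin_adjacent {q : ℂ} {m N k : ℕ} {M : Matrix (Fin N) (Fin N) B}
    (hM : IsManin2 q m M) {i j : Fin k} (hij : (j : ℕ) = i + 1) :
    (1 - cmap (Pperm q m (Equiv.swap i j))) * MProd m M k *
      (1 + cmap (Pperm q m (Equiv.swap i j))) = 0 := by
  have hblock : (1 - cmap (Pperm q m (Equiv.swap i j))) * (Mslot m M i * Mslot m M j) *
      (1 + cmap (Pperm q m (Equiv.swap i j))) = 0 := by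
    ext f g
    rw [manin_block_apply q m hij, hM.maninEntry_eq_zero]
    simp
  have hsplit : List.finRange k =
      (List.finRange k).take i ++ i :: j :: (List.finRange k).drop (i + 2) := by
    have hi : (i : ℕ) < (List.finRange k).length := by simp
    have hj : (i : ℕ) + 1 < (List.finRange k).length := by simp [← hij]
    conv_lhs => rw [← List.take_append_drop i (List.finRange k), List.drop_eq_getElem_cons hi,
      List.drop_eq_getElem_cons hj]
    have := j.isLt
    simp [← hij]
    omega
  have hnodup := List.nodup_finRange k
  rw [hsplit] at hnodup
  generalize (List.finRange k).take i = l₁, (List.finRange k).drop (i + 2) = l₂ at hsplit hnodup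
  have hcomm : ∀ l : List (Fin k), i ∉ l → j ∉ l →
      Commute (cmap (B := B) (Pperm q m (N := N) (Equiv.swap i j))) (l.map (Mslot m M)).prod := by
    intro l hi hj
    refine Commute.list_prod_right _ _ fun x hx => ?_
    obtain ⟨a, ha, rfl⟩ := List.mem_map.1 hx
    exact Pperm_swap_commute_Mslot q m hij M (fun e => hi (e ▸ ha)) (fun e => hj (e ▸ ha))
  have hc₁ := (Commute.one_left _).sub_left (hcomm l₁ (by grind) (by grind))
  have hc₂ := (Commute.one_left _).add_left (hcomm l₂ (by grind) (by grind))
  have hprod : MProd m M k = (l₁.map (Mslot m M)).prod *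
      ((Mslot m M i * Mslot m M j) * (l₂.map (Mslot m M)).prod) := by
    simp [MProd, List.ofFn_eq_map, hsplit, mul_assoc]
  rw [hprod, ← mul_assoc, hc₁.eq, mul_assoc, mul_assoc, mul_assoc, ← hc₂.eq,
    ← mul_assoc (Mslot m M i * _), ← mul_assoc (1 - _), ← mul_assoc (1 - _), hblock, zero_mul,
    mul_zero]

theorem Pperm_mul_MProd_mul_HqS {q : ℂ} (hq : q ≠ 0) {m N k : ℕ}
    {M : Matrix (Fin N) (Fin N) B} (hM : IsManin2 q m M) (σ : Equiv.Perm (Fin k)) :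
    cmap (Pperm q m σ) * (MProd m M k * cmap (HqS q m Finset.univ)) =
      MProd m M k * cmap (HqS q m Finset.univ) := by
  cases k with
  | zero => rw [Subsingleton.elim σ 1, Pperm_one, cmap_one, one_mul]
  | succ n =>
    have hσ : σ ∈ Submonoid.closure
        (Set.range fun i : Fin n => Equiv.swap i.castSucc i.succ) := by
      rw [Equiv.Perm.mclosure_swap_castSucc_succ]; trivial
    induction hσ using Submonoid.closure_induction with
    | mem σ hσ =>
      obtain ⟨i, rfl⟩ := hσ
      have h := MProd_manin_adjacent hM (i := i.castSucc) (j := i.succ) (by simp)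
      have hH : cmap (B := B) (Pperm q m (Equiv.swap i.castSucc i.succ)) *
          cmap (HqS q m (N := N) Finset.univ) = cmap (HqS q m Finset.univ) := by
        rw [← cmap_mul, Pperm_mul_HqS hq]
      have h2 := congrArg (· * cmap (HqS q m Finset.univ)) h
      simp only [mul_assoc, add_mul, one_mul, hH, zero_mul] at h2
      rw [← two_smul ℂ (cmap _), mul_smul_comm, mul_smul_comm,
        smul_eq_zero_iff_right (two_ne_zero), sub_mul, one_mul, sub_eq_zero] at h2
      exact h2.symm
    | one => rw [Pperm_one, cmap_one, one_mul]
    | mul σ τ _ _ hσ hτ => rw [← Pperm_mul hq, cmap_mul, mul_assoc, hτ, hσ]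

/-- `ℋ_k^q M₁⋯M_k ℋ_k^q = M₁⋯M_k ℋ_k^q` for a `q`-super Manin matrix. -/
theorem stmt7 (m n k : ℕ) (q : ℂ) (hq : q ≠ 0) (A : Type*) [Ring A] [Algebra ℂ A]
    (M : Matrix (Fin (m + n)) (Fin (m + n)) A) (hM : IsManin2 q m M) :
    cmap (HqS q m (Finset.univ : Finset (Fin k))) * MProd m M k *
        cmap (HqS q m (Finset.univ : Finset (Fin k)))
      = MProd m M k * cmap (HqS q m (Finset.univ : Finset (Fin k))) := by
  have hk : (k.factorial : ℂ) ≠ 0 := Nat.cast_ne_zero.2 k.factorial_ne_zero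
  nth_rewrite 1 [HqS_univ]
  rw [mul_assoc, cmap_smul, cmap_sum, smul_mul_assoc, Finset.sum_mul]
  simp only [Pperm_mul_MProd_mul_HqS hq hM]
  rw [Finset.sum_const, Finset.card_univ, Fintype.card_perm, Fintype.card_fin,
    ← Nat.cast_smul_eq_nsmul ℂ, smul_smul, inv_mul_cancel₀ hk, one_smul]

end QSM
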